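/- Let d ≥ 1, n ≥ 2 and let α be an integer with max{d, n} ≤ α ≤ dn. Then every X ∈ 𝔹^{d×n}_{≠0} with ‖X‖₀ = α satisfies C_P(X) · L(α, n) ≤ U(α, n, d) · C_D(X) (i.e., C_P(X)/C_D(X) ≤ U(α, n, d)/L(α, n)). Moreover, this bound is tight: there exists X ∈ 𝔹^{d×n}_{≠0} with ‖X‖₀ = α such that simultaneously C_P(X) = U(α, n, d) and C_D(X) = L(α, n). -/

import Mathlib

open scoped BigOperators

/-- Number of nonzero entries of row `i` of `X`. -/
noncomputable def nnzRow {d n : ℕ} (X : Matrix (Fin d) (Fin n) ℝ) (i : Fin d) : ℕ :=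
  (Finset.univ.filter fun j => X i j ≠ 0).card

/-- Number of nonzero entries of column `j` of `X`. -/
noncomputable def nnzCol {d n : ℕ} (X : Matrix (Fin d) (Fin n) ℝ) (j : Fin n) : ℕ :=
  (Finset.univ.filter fun i => X i j ≠ 0).card

/-- Total number of nonzero entries of `X`. -/
noncomputable def nnz {d n : ℕ} (X : Matrix (Fin d) (Fin n) ℝ) : ℕ :=
  ∑ i, nnzRow X i

/-- `X` has all its entries in `{−1, 0, 1}`. -/
def IsBinary {d n : ℕ} (X : Matrix (Fin d) (Fin n) ℝ) : Prop :=
  ∀ i j, X i j = -1 ∨ X i j = 0 ∨ X i j = 1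

/-- `X` has no zero row and no zero column. -/
def NoZeroRowCol {d n : ℕ} (X : Matrix (Fin d) (Fin n) ℝ) : Prop :=
  (∀ i, ∃ j, X i j ≠ 0) ∧ (∀ j, ∃ i, X i j ≠ 0)

/-- For binary matrices, `C_P(X) = ∑ᵢ ‖X₍i:₎‖₀²`. -/
noncomputable def CP {d n : ℕ} (X : Matrix (Fin d) (Fin n) ℝ) : ℕ :=
  ∑ i, nnzRow X i ^ 2

/-- For binary matrices, `C_D(X) = ∑ⱼ ‖X₍:j₎‖₀²`. -/
noncomputable def CD {d n : ℕ} (X : Matrix (Fin d) (Fin n) ℝ) : ℕ :=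
  ∑ j, nnzCol X j ^ 2

/-- `ā_b = b⌊a/b⌋`: `a` rounded down to the closest multiple of `b`. -/
def rnd (a b : ℕ) : ℕ := b * (a / b)

/-- `L(α, n) = (1/n)(ᾱ_n² + (α − ᾱ_n)(2ᾱ_n + n))`. -/
noncomputable def Lfun (α n : ℕ) : ℝ :=
  (1 / (n : ℝ)) * ((rnd α n : ℝ) ^ 2 +
    ((α - rnd α n : ℕ) : ℝ) * (2 * (rnd α n : ℝ) + (n : ℝ)))

/-- `U(α, d, n) = (d+1)·(α−n)̄_{d−1} + n − 1 + (α − n + 1 − (α−n)̄_{d−1})²`. -/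
noncomputable def Ufun (α d n : ℕ) : ℝ :=
  ((d : ℝ) + 1) * (rnd (α - n) (d - 1) : ℝ) + (n : ℝ) - 1 +
    ((α - n + 1 - rnd (α - n) (d - 1) : ℕ) : ℝ) ^ 2

/-- Maximum of the sum of squares of numbers in `[0, m]` with total `s`. -/
def sqMax (m s : ℕ) : ℕ := (s / m) * m ^ 2 + (s % m) ^ 2

lemma sqMax_add (m s b : ℕ) (hm : 0 < m) (hb : b ≤ m) :
    b ^ 2 + sqMax m s ≤ sqMax m (b + s) := by
  unfold sqMax
  have h0 := Nat.div_add_mod s m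
  have h1 := Nat.mod_lt s hm
  set q := s / m
  set r := s % m
  by_cases h : b + r < m
  · have e : b + s = (b + r) + m * q := by omega
    rw [e, Nat.add_mul_div_left _ _ hm, Nat.add_mul_mod_self_left, Nat.div_eq_of_lt h,
      Nat.mod_eq_of_lt h]
    nlinarith [Nat.zero_le (b * r)]
  · obtain ⟨c, hc⟩ : ∃ c, b + r = m + c := ⟨b + r - m, by omega⟩
    have e : b + s = c + m * (q + 1) := by
      rw [Nat.mul_add]; omega
    have hcm : c < m := by omega
    rw [e, Nat.add_mul_div_left _ _ hm, Nat.add_mul_mod_self_left, Nat.div_eq_of_lt hcm,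
      Nat.mod_eq_of_lt hcm]
    obtain ⟨u, hu⟩ : ∃ u, m = b + u := ⟨m - b, by omega⟩
    obtain ⟨v, hv⟩ : ∃ v, m = r + v := ⟨m - r, by omega⟩
    have hr : r = u + c := by omega
    have hb' : b = v + c := by omega
    have hm' : m = u + v + c := by omega
    rw [hr, hb', hm']
    nlinarith [Nat.zero_le (u * v)]

lemma sum_sq_le (m : ℕ) (hm : 0 < m) {ι : Type*} (s : Finset ι) (b : ι → ℕ)
    (hb : ∀ i ∈ s, b i ≤ m) : ∑ i ∈ s, b i ^ 2 ≤ sqMax m (∑ i ∈ s, b i) := by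
  classical
  induction s using Finset.induction_on with
  | empty => simp
  | insert a s ha ih =>
    rw [Finset.sum_insert ha, Finset.sum_insert ha]
    have h1 := ih (fun i hi => hb i (Finset.mem_insert_of_mem hi))
    have h2 := sqMax_add m (∑ i ∈ s, b i) (b a) hm (hb a (Finset.mem_insert_self _ _))
    omega

lemma Ufun_eq (d n α : ℕ) (hn : 2 ≤ n) (hα : d ≤ α) :
    Ufun α n d = (sqMax (n - 1) (α - d) : ℝ) + 2 * ((α : ℝ) - d) + d := by
  unfold Ufun sqMax rnd
  obtain ⟨m, rfl⟩ : ∃ m, n = m + 1 := ⟨n - 1, by omega⟩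
  obtain ⟨s, rfl⟩ : ∃ s, α = d + s := ⟨α - d, by omega⟩
  have h0 := Nat.div_add_mod s m
  have e : d + s - d = s := by omega
  have e2 : m + 1 - 1 = m := by omega
  have e3 : s + 1 - m * (s / m) = s % m + 1 := by omega
  rw [e, e2, e3]
  have h1 : (s : ℝ) = m * ((s / m : ℕ) : ℝ) + ((s % m : ℕ) : ℝ) := by exact_mod_cast h0.symm
  push_cast [h1] at *
  generalize ((s / m : ℕ) : ℝ) = q at *
  generalize ((s % m : ℕ) : ℝ) = r at *
  rw [h1]
  ring

lemma Lfun_eq (n α : ℕ) (hn : 2 ≤ n) :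
    Lfun α n = (2 * ((α / n : ℕ) : ℝ) + 1) * α
      - n * (((α / n : ℕ) : ℝ) * (((α / n : ℕ) : ℝ) + 1)) := by
  unfold Lfun rnd
  have h0 := Nat.div_add_mod α n
  have e : α - n * (α / n) = α % n := by omega
  rw [e]
  have h1 : (α : ℝ) = n * ((α / n : ℕ) : ℝ) + ((α % n : ℕ) : ℝ) := by exact_mod_cast h0.symm
  have hn0 : (n : ℝ) ≠ 0 := by positivity
  rw [Nat.cast_mul]
  generalize ((α / n : ℕ) : ℝ) = q at *
  generalize ((α % n : ℕ) : ℝ) = r at *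
  rw [h1]
  field_simp
  ring

lemma nnz_eq_col {d n : ℕ} (X : Matrix (Fin d) (Fin n) ℝ) : nnz X = ∑ j, nnzCol X j := by
  classical
  unfold nnz nnzRow nnzCol
  simp only [Finset.card_filter]
  exact Finset.sum_comm

lemma CD_ge {d n α : ℕ} (hn : 2 ≤ n) (X : Matrix (Fin d) (Fin n) ℝ) (h : nnz X = α) :
    Lfun α n ≤ (CD X : ℝ) := by
  rw [Lfun_eq n α hn]
  have hs : (α : ℝ) = ∑ j, (nnzCol X j : ℝ) := by
    rw [← h, nnz_eq_col]; push_cast; rfl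
  unfold CD
  push_cast
  generalize hk : α / n = k
  have key : ∀ j, (2 * (k : ℝ) + 1) * (nnzCol X j : ℝ) - (k : ℝ) * (k + 1)
      ≤ (nnzCol X j : ℝ) ^ 2 := by
    intro j
    generalize nnzCol X j = c
    rcases Nat.lt_or_ge k c with hc | hc
    · have : (k : ℝ) + 1 ≤ c := by exact_mod_cast hc
      nlinarith
    · have : (c : ℝ) ≤ k := by exact_mod_cast hc
      nlinarith
  have := Finset.sum_le_sum (fun j (_ : j ∈ Finset.univ) => key j)
  rw [Finset.sum_sub_distrib, ← Finset.mul_sum, ← hs] at this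
  simpa using this

lemma CD_eq {d n α : ℕ} (hn : 2 ≤ n) (X : Matrix (Fin d) (Fin n) ℝ) (h : nnz X = α)
    (hc : ∀ j, nnzCol X j = α / n ∨ nnzCol X j = α / n + 1) :
    (CD X : ℝ) = Lfun α n := by
  rw [Lfun_eq n α hn]
  have hs : (α : ℝ) = ∑ j, (nnzCol X j : ℝ) := by
    rw [← h, nnz_eq_col]; push_cast; rfl
  unfold CD
  push_cast
  generalize hk : α / n = k at *
  have key : ∀ j, (nnzCol X j : ℝ) ^ 2 =
      (2 * (k : ℝ) + 1) * (nnzCol X j : ℝ) - (k : ℝ) * (k + 1) := by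
    intro j
    rcases hc j with hj | hj <;> rw [hj] <;> push_cast <;> ring
  rw [Finset.sum_congr rfl (fun j _ => key j), Finset.sum_sub_distrib, ← Finset.mul_sum, ← hs]
  simp

lemma CP_eq_of {d n α : ℕ} (X : Matrix (Fin d) (Fin n) ℝ) (b : Fin d → ℕ)
    (hb : ∀ i, nnzRow X i = b i + 1) (h : nnz X = α) :
    α = ∑ i, b i + d ∧ CP X = ∑ i, b i ^ 2 + 2 * ∑ i, b i + d := by
  constructor
  · rw [← h, nnz]
    simp [hb, Finset.sum_add_distrib]
  · unfold CP
    have : ∀ i, nnzRow X i ^ 2 = b i ^ 2 + 2 * b i + 1 := by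
      intro i; rw [hb]; ring
    simp [this, Finset.sum_add_distrib, Finset.mul_sum]

lemma CP_le {d n α : ℕ} (hn : 2 ≤ n) (X : Matrix (Fin d) (Fin n) ℝ)
    (hX : NoZeroRowCol X) (h : nnz X = α) : (CP X : ℝ) ≤ Ufun α n d := by
  have hpos : ∀ i, 1 ≤ nnzRow X i := by
    intro i
    obtain ⟨j, hj⟩ := hX.1 i
    exact Finset.card_pos.2 ⟨j, by simpa using hj⟩
  have hle : ∀ i, nnzRow X i ≤ n := by
    intro i
    simpa [nnzRow] using Finset.card_le_univ (Finset.univ.filter fun j => X i j ≠ 0)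
  obtain ⟨h1, h2⟩ := CP_eq_of X (fun i => nnzRow X i - 1)
    (fun i => by have := hpos i; omega) h
  have h3 := sum_sq_le (n - 1) (by omega) Finset.univ (fun i => nnzRow X i - 1)
    (fun i _ => by have := hle i; omega)
  rw [Ufun_eq d n α hn (by omega)]
  set s := ∑ i, (nnzRow X i - 1) with hs
  have e : α - d = s := by omega
  rw [e]
  have h4 : CP X ≤ sqMax (n - 1) s + 2 * s + d := by omega
  have h5 : (α : ℝ) = s + d := by exact_mod_cast h1
  have h6 : (CP X : ℝ) ≤ sqMax (n - 1) s + 2 * s + d := by exact_mod_cast h4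
  rw [h5]; linarith

/-- Row excesses of the extremal matrix. -/
def exB (m q r i : ℕ) : ℕ := if i < q then m else if i = q then r else 0

lemma sum_exB (m q r d p : ℕ) (hp : 0 < p) (h : q < d ∨ (q = d ∧ r = 0)) :
    ∑ i ∈ Finset.range d, exB m q r i ^ p = q * m ^ p + r ^ p := by
  have hfull : ∑ i ∈ Finset.range q, exB m q r i ^ p = q * m ^ p := by
    rw [Finset.sum_congr rfl (g := fun _ => m ^ p)]
    · simp
    · intro i hi
      have := Finset.mem_range.1 hi
      simp [exB, this]
  rcases h with h | ⟨rfl, rfl⟩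
  · obtain ⟨e, rfl⟩ : ∃ e, d = q + 1 + e := ⟨d - (q + 1), by omega⟩
    rw [Finset.sum_range_add, Finset.sum_range_succ, hfull]
    have : ∑ x ∈ Finset.range e, exB m q r (q + 1 + x) ^ p = 0 := by
      apply Finset.sum_eq_zero
      intro i _
      have h1 : ¬ (q + 1 + i < q) := by omega
      have h2 : ¬ (q + 1 + i = q) := by omega
      simp [exB, h1, h2, hp.ne']
    rw [this]
    simp [exB]
  · rw [hfull]; simp [hp.ne']

/-- Prefix sums. -/
def pre (a : ℕ → ℕ) (i : ℕ) : ℕ := ∑ k ∈ Finset.range i, a k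

/-- The residues of the `i`-th consecutive block. -/
def blk (n : ℕ) (a : ℕ → ℕ) (i : ℕ) : Finset ℕ :=
  (Finset.Ico (pre a i) (pre a i + a i)).image (· % n)

lemma blk_inj (n : ℕ) (a : ℕ → ℕ) (i : ℕ) (h : a i ≤ n) :
    Set.InjOn (· % n) (Finset.Ico (pre a i) (pre a i + a i) : Set ℕ) := by
  apply (Nat.mod_injOn_Ico (pre a i) n).mono
  intro x hx
  simp only [Finset.coe_Ico, Set.mem_Ico] at *
  omega

lemma blk_card (n : ℕ) (a : ℕ → ℕ) (i : ℕ) (h : a i ≤ n) : (blk n a i).card = a i := by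
  unfold blk
  rw [Finset.card_image_of_injOn (blk_inj n a i h)]
  simp

lemma blk_col (n : ℕ) (a : ℕ → ℕ) (j d : ℕ) (h : ∀ i < d, a i ≤ n) :
    (∑ i ∈ Finset.range d, if j ∈ blk n a i then 1 else 0) =
      ((Finset.range (pre a d)).filter (fun t => t % n = j)).card := by
  induction d with
  | zero => simp [pre]
  | succ d ih =>
    rw [Finset.sum_range_succ, ih (fun i hi => h i (by omega))]
    have e : pre a (d + 1) = pre a d + a d := by simp [pre, Finset.sum_range_succ]
    rw [e, Finset.card_filter, Finset.card_filter, Finset.range_eq_Ico, Finset.range_eq_Ico,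
      ← Finset.sum_Ico_consecutive _ (Nat.zero_le _) (Nat.le_add_right (pre a d) (a d))]
    congr 1
    rw [← Finset.card_filter]
    have hinj := blk_inj n a d (h d (by omega))
    split_ifs with hj
    · obtain ⟨t, ht, htj⟩ := Finset.mem_image.1 hj
      symm
      rw [Finset.card_eq_one]
      refine ⟨t, ?_⟩
      ext u
      simp only [Finset.mem_filter, Finset.mem_singleton]
      constructor
      · rintro ⟨hu, huj⟩
        exact hinj (by exact_mod_cast hu) (by exact_mod_cast ht) (by simp only; omega)
      · rintro rfl
        exact ⟨ht, htj⟩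
    · symm
      rw [Finset.card_eq_zero, Finset.filter_eq_empty_iff]
      intro t ht htj
      exact hj (Finset.mem_image.2 ⟨t, ht, htj⟩)

lemma card_mod (n α j : ℕ) (hj : j < n) :
    ((Finset.range α).filter (fun t => t % n = j)).card =
      α / n + if j < α % n then 1 else 0 := by
  have := Nat.count_modEq_card α (show 0 < n by omega) j
  rw [Nat.count_eq_card_filter_range] at this
  simpa [Nat.ModEq, Nat.mod_eq_of_lt hj] using this

lemma exists_matrix (d n α : ℕ) (hn : 2 ≤ n) (a : ℕ → ℕ) (ha : ∀ i < d, a i ≤ n)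
    (ha1 : ∀ i < d, 1 ≤ a i) (hsum : pre a d = α) (hα : n ≤ α) :
    ∃ X : Matrix (Fin d) (Fin n) ℝ, IsBinary X ∧ NoZeroRowCol X ∧
      (∀ i : Fin d, nnzRow X i = a i) ∧
      (∀ j, nnzCol X j = α / n ∨ nnzCol X j = α / n + 1) := by
  classical
  let X : Matrix (Fin d) (Fin n) ℝ := fun i j => if (j : ℕ) ∈ blk n a i then 1 else 0
  have hX : ∀ i j, X i j ≠ 0 ↔ (j : ℕ) ∈ blk n a i := by
    intro i j; simp [X]
  have hrow : ∀ i : Fin d, nnzRow X i = a i := by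
    intro i
    rw [← blk_card n a i (ha i i.2)]
    unfold nnzRow
    apply Finset.card_bij (fun (j : Fin n) _ => (j : ℕ))
    · intro j hj
      exact (hX i j).1 (by simpa using hj)
    · intro j _ j' _ h
      exact Fin.ext h
    · intro t ht
      have htn : t < n := by
        obtain ⟨u, _, rfl⟩ := Finset.mem_image.1 ht
        exact Nat.mod_lt _ (by omega)
      exact ⟨⟨t, htn⟩, by simpa using (hX i ⟨t, htn⟩).2 ht, rfl⟩
  have hcol : ∀ j : Fin n, nnzCol X j = α / n + if (j : ℕ) < α % n then 1 else 0 := by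
    intro j
    rw [← card_mod n α j j.2, ← hsum, ← blk_col n a j d ha]
    unfold nnzCol
    rw [Finset.card_filter]
    simp only [hX]
    exact Fin.sum_univ_eq_sum_range (fun i => if (j : ℕ) ∈ blk n a i then 1 else 0) d
  refine ⟨X, ?_, ⟨?_, ?_⟩, hrow, ?_⟩
  · intro i j
    by_cases h : (j : ℕ) ∈ blk n a i <;> simp [X, h]
  · intro i
    have h : 0 < nnzRow X i := by rw [hrow]; exact ha1 i i.2
    obtain ⟨j, hj⟩ := Finset.card_pos.1 h
    exact ⟨j, by simpa using hj⟩
  · intro j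
    have h : 0 < nnzCol X j := by
      rw [hcol]
      have := Nat.div_pos hα (by omega)
      omega
    obtain ⟨i, hi⟩ := Finset.card_pos.1 h
    exact ⟨i, by simpa using hi⟩
  · intro j
    rw [hcol]
    split_ifs <;> simp

/-- Every binary `d×n` matrix with no zero row or column and `α` nonzero entries
satisfies `C_P(X) · L(α, n) ≤ U(α, n, d) · C_D(X)`
(i.e. `C_P(X)/C_D(X) ≤ U(α, n, d)/L(α, n) = R(α, d, n)`), and this bound is
tight: some such matrix attains `C_P = U(α, n, d)` and `C_D = L(α, n)`
simultaneously. -/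
theorem ratio_upper_bound_tight
    (d n α : ℕ) (hd : 1 ≤ d) (hn : 2 ≤ n)
    (hα₁ : max d n ≤ α) (hα₂ : α ≤ d * n) :
    (∀ X : Matrix (Fin d) (Fin n) ℝ,
      IsBinary X → NoZeroRowCol X → nnz X = α →
        (CP X : ℝ) * Lfun α n ≤ Ufun α n d * (CD X : ℝ)) ∧
    (∃ X : Matrix (Fin d) (Fin n) ℝ,
      IsBinary X ∧ NoZeroRowCol X ∧ nnz X = α ∧
        (CP X : ℝ) = Ufun α n d ∧ (CD X : ℝ) = Lfun α n) := by
  have hdα : d ≤ α := le_trans (le_max_left _ _) hα₁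
  have hnα : n ≤ α := le_trans (le_max_right _ _) hα₁
  constructor
  · intro X _ hX h
    have h1 := CP_le hn X hX h
    have h2 := CD_ge hn X h
    have h3 : (0 : ℝ) ≤ CP X := by positivity
    have h4 : (0 : ℝ) ≤ CD X := by positivity
    calc (CP X : ℝ) * Lfun α n ≤ CP X * CD X := by gcongr
      _ ≤ _ := by gcongr
  · obtain ⟨m, rfl⟩ : ∃ m, n = m + 1 := ⟨n - 1, by omega⟩
    have hm : 0 < m := by omega
    have h0 := Nat.div_add_mod (α - d) m
    have hr := Nat.mod_lt (α - d) hm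
    have hUf := Ufun_eq d (m + 1) α hn hdα
    rw [Nat.add_sub_cancel, sqMax] at hUf
    have hle : α - d ≤ d * m := by
      rw [Nat.mul_add] at hα₂; omega
    generalize (α - d) / m = q at *
    generalize (α - d) % m = r at *
    have hq : q < d ∨ (q = d ∧ r = 0) := by
      have hqd : q ≤ d := by
        by_contra hc
        have : m * (d + 1) ≤ m * q := Nat.mul_le_mul_left m (by omega)
        rw [Nat.mul_add, Nat.mul_comm m d] at this
        omega
      rcases Nat.lt_or_ge q d with h | h
      · exact Or.inl h
      · right
        have e : q = d := by omega
        subst e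
        rw [Nat.mul_comm] at hle
        omega
    have hb : ∀ i, exB m q r i ≤ m := by
      intro i; unfold exB; split_ifs <;> omega
    have hs1 := sum_exB m q r d 1 (by omega) hq
    have hs2 := sum_exB m q r d 2 (by omega) hq
    simp only [pow_one] at hs1
    have hqm : q * m + r = α - d := by rw [Nat.mul_comm]; exact h0
    obtain ⟨X, hX1, hX2, hX3, hX4⟩ := exists_matrix d (m + 1) α hn
      (fun i => exB m q r i + 1) (fun i _ => by have := hb i; omega)
      (fun i _ => by simp) (by
        unfold pre
        rw [Finset.sum_add_distrib, hs1]
        simp; omega) hnα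
    have hnnz : nnz X = α := by
      unfold nnz
      rw [Finset.sum_congr rfl (fun i _ => hX3 i), Finset.sum_add_distrib,
        Fin.sum_univ_eq_sum_range (fun i => exB m q r i) d, hs1]
      simp; omega
    refine ⟨X, hX1, hX2, hnnz, ?_, CD_eq hn X hnnz hX4⟩
    obtain ⟨-, h2⟩ := CP_eq_of X (fun i => exB m q r i) hX3 hnnz
    rw [Fin.sum_univ_eq_sum_range (fun i => exB m q r i) d,
      Fin.sum_univ_eq_sum_range (fun i => exB m q r i ^ 2) d, hs1, hs2, hqm] at h2
    rw [hUf, h2]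
    push_cast [Nat.cast_sub hdα]
    ring
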